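/- Fix positive integers m and n. In the field ℚ(q, t, x_1, …, x_m, z_1, …, z_n) of rational functions in independent indeterminates over ℚ, one has Σ_{f : {1,…,n} → {1,…,m}} ( ∏_{α=1}^{n} x_{f(α)} ) · ∏_{1≤α<β≤n} γ_{f(α), f(β)}(z_α, z_β; q, t) = Σ_{λ ⊢ n} ( n! / ∏_{i=1}^{ℓ(λ)} λ_i! ) · m_λ(x_1,…,x_m) · ε_λ(z_1,…,z_n; t), where the second sum runs over all partitions λ of n (and m_λ(x_1,…,x_m) = 0 when λ has more than m parts). -/

import Mathlib

noncomputable section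

/-- The field ℚ(q, t, x_1, …, x_m, z_1, …, z_n) of rational functions in
`2 + m + n` independent indeterminates over ℚ. -/
abbrev K (m n : ℕ) : Type := FractionRing (MvPolynomial (Fin 2 ⊕ Fin m ⊕ Fin n) ℚ)

def q (m n : ℕ) : K m n :=
  algebraMap (MvPolynomial (Fin 2 ⊕ Fin m ⊕ Fin n) ℚ) (K m n) (MvPolynomial.X (Sum.inl 0))
def t (m n : ℕ) : K m n :=
  algebraMap (MvPolynomial (Fin 2 ⊕ Fin m ⊕ Fin n) ℚ) (K m n) (MvPolynomial.X (Sum.inl 1))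
def x (m n : ℕ) (i : Fin m) : K m n :=
  algebraMap (MvPolynomial (Fin 2 ⊕ Fin m ⊕ Fin n) ℚ) (K m n)
    (MvPolynomial.X (Sum.inr (Sum.inl i)))
def z (m n : ℕ) (a : Fin n) : K m n :=
  algebraMap (MvPolynomial (Fin 2 ⊕ Fin m ⊕ Fin n) ℚ) (K m n)
    (MvPolynomial.X (Sum.inr (Sum.inr a)))

/-- `γ_{a,b}(z,w;q,t)`, depending on the comparison of the indices `a`, `b`. -/
def gam {F : Type*} [Field F] (q t : F) (a b : ℕ) (zz ww : F) : F :=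
  if a = b then (zz - t * ww) * (zz - t⁻¹ * ww) / (zz - ww) ^ 2
  else if a < b then
    (zz - q⁻¹ * ww) * (zz - t * ww) * (zz - q * t⁻¹ * ww) / (zz - ww) ^ 3
  else (zz - q * ww) * (zz - t⁻¹ * ww) * (zz - q⁻¹ * t * ww) / (zz - ww) ^ 3

/-- The pairwise factor `(x - t y)(x - t⁻¹ y)/(x - y)²` of `ε_r(·;t)`. -/
def epsfac {F : Type*} [Field F] (t xx yy : F) : F :=
  (xx - t * yy) * (xx - t⁻¹ * yy) / (xx - yy) ^ 2

/-- `ω(x,y) = (x - q⁻¹ y)(x - t y)(x - q t⁻¹ y)/(x - y)³`. -/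
def om {F : Type*} [Field F] (q t xx yy : F) : F :=
  (xx - q⁻¹ * yy) * (xx - t * yy) * (xx - q * t⁻¹ * yy) / (xx - yy) ^ 3

/-- The parts of a partition `p ⊢ n`, listed in weakly decreasing order. -/
def partsList {n : ℕ} (p : n.Partition) : List ℕ := (p.parts.sort (· ≤ ·)).reverse

/-- The (0-indexed) index of the block (= part of λ) containing the
(0-indexed) position `a ∈ {0,…,n-1}`: positions `N_{k-1} ≤ a < N_k` (with
`N_k = λ_1 + ⋯ + λ_k`) lie in block `k-1`. -/
def blk {n : ℕ} (p : n.Partition) (a : ℕ) : ℕ :=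
  ((Finset.range (partsList p).length).filter fun k =>
    ((partsList p).take (k + 1)).sum ≤ a).card

/-- `ε_λ(z_1,…,z_n;t) = (1/n!) Σ_{σ ∈ S_n} ∏_{a<b} [ε-factor if a,b in the same
block of λ, ω-factor otherwise]`, evaluated at `z_{σ(a)}, z_{σ(b)}`. -/
def epsPart (m n : ℕ) (p : n.Partition) : K m n :=
  (n.factorial : K m n)⁻¹ *
    ∑ σ : Equiv.Perm (Fin n), ∏ a : Fin n,
      ∏ b ∈ Finset.univ.filter fun b => a < b,
        if blk p (a : ℕ) = blk p (b : ℕ) then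
          epsfac (t m n) (z m n (σ a)) (z m n (σ b))
        else om (q m n) (t m n) (z m n (σ a)) (z m n (σ b))

/-- The monomial symmetric polynomial `m_λ(x_1,…,x_m)`: the sum of all distinct
monomials `x^a` whose exponent multiset is the multiset of parts of λ padded
with zeros to length `m` (zero if λ has more than `m` parts). -/
def msymm (m n : ℕ) (p : n.Partition) : K m n :=
  ∑ a : Fin m → Fin (n + 1),
    if (Finset.univ.val.map fun i => ((a i : ℕ)))
        = p.parts + Multiset.replicate (m - p.parts.card) 0 then
      ∏ i, x m n i ^ (a i : ℕ)
    else 0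

section CutSums

open Finset Polynomial

/-- The sum, over all `A ⊆ S`, of the products of `h a b` over `a ∈ A`, `b ∈ S \ A`, weighted by a
function of the cardinality of `A`. -/
def cutSum {R ι : Type*} [CommRing R] [DecidableEq ι] (h : ι → ι → R) (c : ℕ → R)
    (S : Finset ι) : R :=
  ∑ A ∈ S.powerset, c #A * ∏ a ∈ A, ∏ b ∈ S \ A, h a b

/-- The sum `cutSum` over a set with one further element, whose factors with the elements of `S`
are `f`, `g` (according to its side of the cut) and `d` (for elements on its own side). -/
def cutSumExt {R ι : Type*} [CommRing R] [DecidableEq ι] (h : ι → ι → R) (f g d : ι → R)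
    (c : ℕ → R) (S : Finset ι) : R :=
  ∑ A ∈ S.powerset, (c (#A + 1) * ∏ b ∈ S, (if b ∈ A then d b else f b) +
    c #A * ∏ b ∈ S, (if b ∈ A then g b else d b)) * ∏ a ∈ A, ∏ b ∈ S \ A, h a b

theorem prod_ite_mem_of_subset {R ι : Type*} [CommRing R] [DecidableEq ι] {A S : Finset ι}
    (hA : A ⊆ S) (f g : ι → R) :
    ∏ b ∈ S, (if b ∈ A then f b else g b) = (∏ b ∈ A, f b) * ∏ b ∈ S \ A, g b := by
  rw [prod_ite, filter_mem_eq_inter, inter_eq_right.2 hA, filter_notMem_eq_sdiff]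

theorem cutSum_insert {R ι : Type*} [CommRing R] [DecidableEq ι] (h : ι → ι → R) (c : ℕ → R)
    {i : ι} {S : Finset ι} (hi : i ∉ S) :
    cutSum h c (insert i S) = cutSumExt h (h i) (fun b => h b i) 1 c S := by
  rw [cutSum, cutSumExt, sum_powerset_insert hi, ← sum_add_distrib]
  refine sum_congr rfl fun A hA => ?_
  have hA := mem_powerset.1 hA
  have hiA : i ∉ A := fun h => hi (hA h)
  rw [insert_sdiff_of_notMem _ hiA, insert_sdiff_insert, sdiff_insert_of_notMem hi,
    card_insert_of_notMem hiA, prod_insert hiA, prod_ite_mem_of_subset hA,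
    prod_ite_mem_of_subset hA]
  have : ∏ a ∈ A, ∏ b ∈ insert i (S \ A), h a b
      = (∏ a ∈ A, h a i) * ∏ a ∈ A, ∏ b ∈ S \ A, h a b := by
    rw [← prod_mul_distrib]
    exact prod_congr rfl fun a _ => prod_insert (by simp [hi])
  rw [this]
  simp only [Pi.one_apply, prod_const_one]
  ring

theorem cutSumExt_mul {R ι : Type*} [CommRing R] [DecidableEq ι] (h : ι → ι → R)
    (e f g d : ι → R) (c : ℕ → R) (S : Finset ι) :
    cutSumExt h (e * f) (e * g) (e * d) c S = (∏ b ∈ S, e b) * cutSumExt h f g d c S := by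
  rw [cutSumExt, cutSumExt, mul_sum]
  refine sum_congr rfl fun A _ => ?_
  simp only [Pi.mul_apply, ← mul_ite, prod_mul_distrib]
  ring

theorem cutSumExt_congr {R ι : Type*} [CommRing R] [DecidableEq ι] (h : ι → ι → R)
    {f f' g g' d d' : ι → R} (c : ℕ → R) {S : Finset ι} (hf : ∀ b ∈ S, f b = f' b)
    (hg : ∀ b ∈ S, g b = g' b) (hd : ∀ b ∈ S, d b = d' b) :
    cutSumExt h f g d c S = cutSumExt h f' g' d' c S := by
  refine sum_congr rfl fun A _ => ?_
  congr 3 <;> exact prod_congr rfl fun b hb => by simp only [hf b hb, hg b hb, hd b hb]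

theorem cutSumExt_insert {R ι : Type*} [CommRing R] [DecidableEq ι] (h : ι → ι → R)
    (f g d : ι → R) (c : ℕ → R) {j : ι} {S : Finset ι} (hj : j ∉ S) (hd : d j = 0) :
    cutSumExt h f g d c (insert j S) =
      f j * ∑ A ∈ S.powerset, c (#A + 1) *
        (∏ b ∈ S, if b ∈ A then d b * h b j else f b) * ∏ a ∈ A, ∏ b ∈ S \ A, h a b +
      g j * ∑ A ∈ S.powerset, c (#A + 1) *
        (∏ b ∈ S, if b ∈ A then g b else d b * h j b) * ∏ a ∈ A, ∏ b ∈ S \ A, h a b := by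
  rw [cutSumExt, sum_powerset_insert hj, mul_sum, mul_sum]
  congr 1 <;> refine sum_congr rfl fun A hA => ?_
  · have hA := mem_powerset.1 hA
    have hjA : j ∉ A := fun h => hj (hA h)
    have : ∏ a ∈ A, ∏ b ∈ insert j (S \ A), h a b
        = (∏ a ∈ A, h a j) * ∏ a ∈ A, ∏ b ∈ S \ A, h a b := by
      rw [← prod_mul_distrib]
      exact prod_congr rfl fun a _ => prod_insert (by simp [hj])
    rw [insert_sdiff_of_notMem _ hjA, this, prod_insert hj, prod_insert hj, if_neg hjA,
      if_neg hjA, hd, prod_ite_mem_of_subset hA, prod_ite_mem_of_subset hA,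
      prod_ite_mem_of_subset hA, prod_mul_distrib]
    ring
  · have hA := mem_powerset.1 hA
    have hjA : j ∉ A := fun h => hj (hA h)
    have : ∏ b ∈ S, (if b ∈ insert j A then g b else d b) =
        ∏ b ∈ S, (if b ∈ A then g b else d b) := by
      refine prod_congr rfl fun b hb => ?_
      have : b ≠ j := fun h => hj (h ▸ hb)
      simp [this]
    rw [insert_sdiff_insert, sdiff_insert_of_notMem hj, card_insert_of_notMem hjA,
      prod_insert hjA, prod_insert hj, prod_insert hj, if_pos (mem_insert_self _ _),
      if_pos (mem_insert_self _ _), hd, this, prod_ite_mem_of_subset hA,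
      prod_ite_mem_of_subset hA, prod_mul_distrib]
    ring

theorem cutSumExt_insert_eq_zero {R ι : Type*} [CommRing R] [DecidableEq ι] (h : ι → ι → R)
    (f g d : ι → R) (c : ℕ → R) {j : ι} {S : Finset ι} (hj : j ∉ S) (hd : d j = 0)
    (hfg : g j = -f j) (hf : ∀ b ∈ S, d b * h j b = f b) (hg : ∀ b ∈ S, d b * h b j = g b) :
    cutSumExt h f g d c (insert j S) = 0 := by
  rw [cutSumExt_insert h f g d c hj hd, hfg, neg_mul, ← sub_eq_add_neg, sub_eq_zero]
  congr 1
  refine sum_congr rfl fun A _ => ?_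
  congr 2
  exact prod_congr rfl fun b hb => by rw [hf b hb, hg b hb]

theorem cutSumExt_insert_of_right_eq_zero {R ι : Type*} [CommRing R] [DecidableEq ι]
    (h : ι → ι → R) (f g d : ι → R) (c : ℕ → R) {j : ι} {S : Finset ι} (hj : j ∉ S)
    (hd : d j = 0) (hg : g j = 0) (hf : ∀ b ∈ S, d b * h b j = f b) :
    cutSumExt h f g d c (insert j S) =
      (f j * ∏ b ∈ S, f b) * cutSum h (fun k => c (k + 1)) S := by
  rw [cutSumExt_insert h f g d c hj hd, hg, zero_mul, add_zero, cutSum, mul_assoc, mul_sum _ _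
    (∏ b ∈ S, f b)]
  congr 1
  refine sum_congr rfl fun A _ => ?_
  rw [prod_congr rfl fun b hb => by rw [hf b hb, ite_self]]
  ring

theorem cutSumExt_insert_of_left_eq_zero {R ι : Type*} [CommRing R] [DecidableEq ι]
    (h : ι → ι → R) (f g d : ι → R) (c : ℕ → R) {j : ι} {S : Finset ι} (hj : j ∉ S)
    (hd : d j = 0) (hf : f j = 0) (hg : ∀ b ∈ S, d b * h j b = g b) :
    cutSumExt h f g d c (insert j S) =
      (g j * ∏ b ∈ S, g b) * cutSum h (fun k => c (k + 1)) S := by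
  rw [cutSumExt_insert h f g d c hj hd, hf, zero_mul, zero_add, cutSum, mul_assoc, mul_sum _ _
    (∏ b ∈ S, g b)]
  congr 1
  refine sum_congr rfl fun A _ => ?_
  rw [prod_congr rfl fun b hb => by rw [hg b hb, ite_self]]
  ring

theorem map_cutSumExt {R R' ι : Type*} [CommRing R] [CommRing R'] [DecidableEq ι]
    (φ : R →+* R') (h : ι → ι → R) (f g d : ι → R) (c : ℕ → R) (S : Finset ι) :
    φ (cutSumExt h f g d c S) = cutSumExt (fun a b => φ (h a b)) (fun b => φ (f b))
      (fun b => φ (g b)) (fun b => φ (d b)) (fun k => φ (c k)) S := by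
  simp only [cutSumExt, map_sum, map_mul, map_add, map_prod, apply_ite φ]

theorem coeff_prod_ite_mem {F ι : Type*} [Field F] [DecidableEq ι] (f g : ι → F[X]) (k : ℕ)
    (r : F) (A S : Finset ι) (hf : ∀ b, (f b).natDegree ≤ k) (hg : ∀ b, (g b).natDegree ≤ k)
    (hf' : ∀ b, (f b).coeff k = r) (hg' : ∀ b, (g b).coeff k = r) :
    (∏ b ∈ S, if b ∈ A then f b else g b).coeff (#S * k) = r ^ #S := by
  rw [coeff_prod_of_natDegree_le]
  · rw [prod_congr rfl fun b _ => (by split_ifs <;> simp [hf', hg'] :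
      (if b ∈ A then f b else g b).coeff k = r), prod_const]
  · intro b _
    split_ifs <;> simp [hf, hg]

theorem natDegree_prod_ite_mem_le {F ι : Type*} [Field F] [DecidableEq ι] (f g : ι → F[X])
    (k : ℕ) (A S : Finset ι) (hf : ∀ b, (f b).natDegree ≤ k) (hg : ∀ b, (g b).natDegree ≤ k) :
    (∏ b ∈ S, if b ∈ A then f b else g b).natDegree ≤ #S * k := by
  refine (natDegree_prod_le _ _).trans ((sum_le_card_nsmul _ _ k fun b _ => ?_).trans (by simp))
  split_ifs <;> simp [hf, hg]

theorem natDegree_cutSumExt_le {F ι : Type*} [Field F] [DecidableEq ι] (h : ι → ι → F)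
    (f g d : ι → F[X]) (c : ℕ → F) (S : Finset ι) (k : ℕ) (hf : ∀ b, (f b).natDegree ≤ k)
    (hg : ∀ b, (g b).natDegree ≤ k) (hd : ∀ b, (d b).natDegree ≤ k) :
    (cutSumExt (fun a b => C (h a b)) f g d (fun k => C (c k)) S).natDegree ≤ #S * k := by
  refine natDegree_sum_le_of_forall_le _ _ fun A _ => ?_
  simp only [← map_prod]
  refine (natDegree_mul_C_le _ _).trans (natDegree_add_le_of_degree_le ?_ ?_)
  · exact (natDegree_C_mul_le _ _).trans (natDegree_prod_ite_mem_le _ _ _ _ _ hd hf)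
  · exact (natDegree_C_mul_le _ _).trans (natDegree_prod_ite_mem_le _ _ _ _ _ hg hd)

theorem coeff_cutSumExt {F ι : Type*} [Field F] [DecidableEq ι] (h : ι → ι → F)
    (f g d : ι → F[X]) (c : ℕ → F) (S : Finset ι) (k : ℕ) (r : F)
    (hf : ∀ b, (f b).natDegree ≤ k) (hg : ∀ b, (g b).natDegree ≤ k)
    (hd : ∀ b, (d b).natDegree ≤ k) (hf' : ∀ b, (f b).coeff k = r)
    (hg' : ∀ b, (g b).coeff k = r) (hd' : ∀ b, (d b).coeff k = r) :
    (cutSumExt (fun a b => C (h a b)) f g d (fun k => C (c k)) S).coeff (#S * k) =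
      r ^ #S * cutSum h (fun k => c (k + 1) + c k) S := by
  rw [cutSumExt, finsetSum_coeff, cutSum, mul_sum]
  refine sum_congr rfl fun A _ => ?_
  simp only [← map_prod]
  rw [coeff_mul_C, coeff_add, coeff_C_mul, coeff_C_mul, coeff_prod_ite_mem d f k r A S hd hf hd' hf',
    coeff_prod_ite_mem g d k r A S hg hd hg' hd']
  ring

/-- The factor of the cut sums of Ruijsenaars' identity. -/
def ruijFactor {F : Type*} [Field F] (u v a b : F) : F :=
  (a - u * b) * (a - v * b) / ((a - b) * (a - u * v * b))

theorem mul_ruijFactor_left {F : Type*} [Field F] (u v y b : F) (h₁ : y ≠ b)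
    (h₂ : y ≠ u * v * b) :
    (y - b) * (y - u * v * b) * (b - u * v * y) * ruijFactor u v y b =
      (y - u * b) * (y - v * b) * (b - u * v * y) := by
  have h₁ := sub_ne_zero.2 h₁
  have h₂ := sub_ne_zero.2 h₂
  rw [ruijFactor, mul_div_assoc', div_eq_iff (mul_ne_zero h₁ h₂)]
  ring

theorem mul_ruijFactor_right {F : Type*} [Field F] (u v y b : F) (h₁ : b ≠ y)
    (h₂ : b ≠ u * v * y) :
    (y - b) * (y - u * v * b) * (b - u * v * y) * ruijFactor u v b y =
      (b - u * y) * (b - v * y) * (u * v * b - y) := by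
  have h₁ := sub_ne_zero.2 h₁
  have h₂ := sub_ne_zero.2 h₂
  rw [ruijFactor, mul_div_assoc', div_eq_iff (mul_ne_zero h₁ h₂)]
  ring

theorem mul_ruijFactor_right_shift {F : Type*} [Field F] (u v y w b : F) (h₁ : b ≠ w)
    (h₂ : b ≠ u * v * w) (hy : y = u * v * w) :
    (y - b) * (y - u * v * b) * (b - u * v * y) * ruijFactor u v b w =
      (y - u * b) * (y - v * b) * (b - u * v * y) := by
  subst hy
  have h₁ := sub_ne_zero.2 h₁
  have h₂ := sub_ne_zero.2 h₂
  rw [ruijFactor, mul_div_assoc', div_eq_iff (mul_ne_zero h₁ h₂)]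
  ring

theorem mul_ruijFactor_left_shift {F : Type*} [Field F] (u v y w b : F) (h₁ : w ≠ b)
    (h₂ : w ≠ u * v * b) (hy : w = u * v * y) :
    (y - b) * (y - u * v * b) * (b - u * v * y) * ruijFactor u v w b =
      (b - u * y) * (b - v * y) * (u * v * b - y) := by
  subst hy
  have h₁ := sub_ne_zero.2 h₁
  have h₂ := sub_ne_zero.2 h₂
  rw [ruijFactor, mul_div_assoc', div_eq_iff (mul_ne_zero h₁ h₂)]
  ring

theorem cutSum_ruijFactor_comm {F ι : Type*} [Field F] [DecidableEq ι] (z : ι → F) (u v : F)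
    (hu : u ≠ 0) (hv : v ≠ 0) (hp : ∀ k : ℤ, (u * v) ^ k = 1 → k = 0) (hz0 : ∀ i, z i ≠ 0)
    (hz : ∀ i j, i ≠ j → ∀ k : ℤ, z i ≠ (u * v) ^ k * z j) (S : Finset ι) :
    ∀ c : ℕ → F, cutSum (fun a b => ruijFactor u v (z a) (z b)) c S =
      cutSum (fun a b => ruijFactor u v (z b) (z a)) c S := by
  induction S using Finset.strongInduction with
  | H S ih =>
  intro c
  obtain rfl | ⟨i, hi⟩ := S.eq_empty_or_nonempty
  · simp [cutSum]
  obtain ⟨S, hiS, rfl⟩ : ∃ T, i ∉ T ∧ S = insert i T :=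
    ⟨S.erase i, notMem_erase i S, (insert_erase hi).symm⟩
  set p := u * v with hpdef
  have hp0 : p ≠ 0 := mul_ne_zero hu hv
  let f (b : ι) : F[X] := (X - C (u * z b)) * (X - C (v * z b)) * (C (z b) - C p * X)
  let g (b : ι) : F[X] := (C (z b) - C u * X) * (C (z b) - C v * X) * (C (p * z b) - X)
  let d (b : ι) : F[X] := (X - C (z b)) * (X - C (p * z b)) * (C (z b) - C p * X)
  have hf : ∀ b, (f b).natDegree ≤ 3 := fun b => by simp only [f]; compute_degree
  have hg : ∀ b, (g b).natDegree ≤ 3 := fun b => by simp only [g]; compute_degree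
  have hd : ∀ b, (d b).natDegree ≤ 3 := fun b => by simp only [d]; compute_degree
  have hf' : ∀ b, (f b).coeff 3 = -p := fun b => by
    simp only [f]; compute_degree!
  have hg' : ∀ b, (g b).coeff 3 = -p := fun b => by
    simp only [g]; compute_degree!
  have hd' : ∀ b, (d b).coeff 3 = -p := fun b => by
    simp only [d]; compute_degree!
  let h (a b : ι) : F := ruijFactor u v (z a) (z b)
  let P : F[X] := cutSumExt (fun a b => C (h a b)) f g d (fun k => C (c k)) S -
    cutSumExt (fun a b => C (h b a)) g f d (fun k => C (c k)) S
  have hPeval (y : F) : P.eval y =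
      cutSumExt h (fun b => (f b).eval y) (fun b => (g b).eval y) (fun b => (d b).eval y) c S -
      cutSumExt (fun a b => h b a) (fun b => (g b).eval y) (fun b => (f b).eval y)
        (fun b => (d b).eval y) c S := by
    simp only [P, eval_sub, ← coe_evalRingHom, map_cutSumExt]
    simp
  have hne {a b : ι} (hab : a ≠ b) : z a ≠ z b ∧ z a ≠ p * z b := by
    simpa using And.intro (hz a b hab 0) (hz a b hab 1)
  have key : P = 0 := by
    have hPdeg : P.degree < #(S ×ˢ (univ : Finset (Fin 3))) := by
      rw [card_product, card_univ, Fintype.card_fin, degree_lt_iff_coeff_zero]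
      intro k hk
      obtain rfl | hk := hk.eq_or_lt
      · simp only [P, coeff_sub]
        rw [coeff_cutSumExt h f g d c S 3 (-p) hf hg hd hf' hg' hd',
          coeff_cutSumExt (fun a b => h b a) g f d c S 3 (-p) hg hf hd hg' hf' hd',
          ih S (ssubset_insert hiS), sub_self]
      · refine coeff_eq_zero_of_natDegree_lt (lt_of_le_of_lt ?_ hk)
        exact natDegree_sub_le_of_le (natDegree_cutSumExt_le h f g d c S 3 hf hg hd)
          (natDegree_cutSumExt_le (fun a b => h b a) g f d c S 3 hg hf hd) |>.trans (by simp)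
    refine Polynomial.eq_zero_of_degree_lt_of_eval_index_eq_zero
      (v := fun a => p ^ ((a.2 : ℤ) - 1) * z a.1) _ ?_ hPdeg ?_
    · rintro ⟨a, k⟩ _ ⟨b, l⟩ _ hab
      simp only at hab
      obtain rfl | hne := eq_or_ne a b
      · have := hp ((k : ℤ) - 1 - ((l : ℤ) - 1)) (by
          rw [zpow_sub₀ hp0, mul_right_cancel₀ (hz0 a) hab, div_self (zpow_ne_zero _ hp0)])
        rw [Prod.mk.injEq]
        exact ⟨rfl, Fin.ext (by omega)⟩
      · refine absurd ?_ (hz a b hne ((l : ℤ) - 1 - ((k : ℤ) - 1)))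
        rw [zpow_sub₀ hp0, div_mul_eq_mul_div, eq_div_iff (zpow_ne_zero _ hp0), mul_comm, hab]
    · rintro ⟨j, k⟩ hj
      obtain ⟨T, hjT, rfl⟩ : ∃ T, j ∉ T ∧ S = insert j T :=
        ⟨S.erase j, notMem_erase j S, (insert_erase (mem_product.1 hj).1).symm⟩
      have hT : ∀ b ∈ T, j ≠ b := fun b hb h => hjT (h ▸ hb)
      have ihT := ih T ((ssubset_insert hjT).trans (ssubset_insert hiS)) fun k => c (k + 1)
      have hf_eval (b : ι) (y : F) :
          (f b).eval y = (y - u * z b) * (y - v * z b) * (z b - p * y) := by simp [f]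
      have hg_eval (b : ι) (y : F) :
          (g b).eval y = (z b - u * y) * (z b - v * y) * (p * z b - y) := by simp [g]
      have hd_eval (b : ι) (y : F) :
          (d b).eval y = (y - z b) * (y - p * z b) * (z b - p * y) := by simp [d]
      have h₀ (y : F) (hy : z j = p * y) : P.eval y = 0 := by
        have hdj : (d j).eval y = 0 := by simp [hd_eval, hy]
        have hfj : (f j).eval y = 0 := by simp [hf_eval, hy]
        have hg' (b : ι) (hb : b ∈ T) : (d b).eval y * h j b = (g b).eval y := by
          rw [hd_eval, hg_eval]
          exact mul_ruijFactor_left_shift u v y _ _ (hne (hT b hb)).1 (hne (hT b hb)).2 hy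
        rw [hPeval, sub_eq_zero, cutSumExt_insert_of_left_eq_zero h _ _ _ c hjT hdj hfj hg',
          cutSumExt_insert_of_right_eq_zero (fun a b => h b a) _ _ _ c hjT hdj hfj hg', ihT]
      have h₁ : P.eval (z j) = 0 := by
        have hdj : (d j).eval (z j) = 0 := by simp [hd_eval]
        have hfg : (g j).eval (z j) = -(f j).eval (z j) := by
          rw [hf_eval, hg_eval]
          ring
        have hf' (b : ι) (hb : b ∈ T) : (d b).eval (z j) * h j b = (f b).eval (z j) := by
          rw [hd_eval, hf_eval]
          exact mul_ruijFactor_left u v _ _ (hne (hT b hb)).1 (hne (hT b hb)).2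
        have hg' (b : ι) (hb : b ∈ T) : (d b).eval (z j) * h b j = (g b).eval (z j) := by
          rw [hd_eval, hg_eval]
          exact mul_ruijFactor_right u v _ _ (hne (hT b hb).symm).1 (hne (hT b hb).symm).2
        rw [hPeval, sub_eq_zero, cutSumExt_insert_eq_zero h _ _ _ c hjT hdj hfg hf' hg',
          cutSumExt_insert_eq_zero (fun a b => h b a) _ _ _ c hjT hdj (by rw [hfg, neg_neg]) hg' hf']
      have h₂ (y : F) (hy : y = p * z j) : P.eval y = 0 := by
        have hdj : (d j).eval y = 0 := by simp [hd_eval, hy]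
        have hgj : (g j).eval y = 0 := by simp [hg_eval, hy]
        have hf' (b : ι) (hb : b ∈ T) : (d b).eval y * h b j = (f b).eval y := by
          rw [hd_eval, hf_eval]
          exact mul_ruijFactor_right_shift u v y _ _ (hne (hT b hb).symm).1
            (hne (hT b hb).symm).2 hy
        rw [hPeval, sub_eq_zero, cutSumExt_insert_of_right_eq_zero h _ _ _ c hjT hdj hgj hf',
          cutSumExt_insert_of_left_eq_zero (fun a b => h b a) _ _ _ c hjT hdj hgj hf', ihT]
      fin_cases k
      · exact h₀ _ (by simp [hp0])
      · simpa using h₁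
      · exact h₂ _ (by simp)
  have hiT : ∀ b ∈ S, i ≠ b := fun b hb h => hiS (h ▸ hb)
  have hdi : ∏ b ∈ S, (d b).eval (z i) ≠ 0 := by
    refine prod_ne_zero_iff.2 fun b hb => ?_
    have h₁ := hne (hiT b hb)
    have h₂ := hne (hiT b hb).symm
    simp [d, sub_ne_zero, h₁, h₂]
  have hfi (b : ι) (hb : b ∈ S) : (f b).eval (z i) = ((fun b => (d b).eval (z i)) * h i) b := by
    rw [Pi.mul_apply]
    simpa [d, f] using
      (mul_ruijFactor_left u v (z i) (z b) (hne (hiT b hb)).1 (hne (hiT b hb)).2).symm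
  have hgi (b : ι) (hb : b ∈ S) :
      (g b).eval (z i) = ((fun b => (d b).eval (z i)) * fun b => h b i) b := by
    rw [Pi.mul_apply]
    simpa [d, g] using
      (mul_ruijFactor_right u v (z i) (z b) (hne (hiT b hb).symm).1 (hne (hiT b hb).symm).2).symm
  have hd1 (b : ι) (_ : b ∈ S) : (d b).eval (z i) = ((fun b => (d b).eval (z i)) * 1) b := by
    simp
  have hfinal := hPeval (z i)
  rw [key, eval_zero, eq_comm, sub_eq_zero, cutSumExt_congr h c hfi hgi hd1,
    cutSumExt_congr (fun a b => h b a) c hgi hfi hd1, cutSumExt_mul, cutSumExt_mul] at hfinal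
  rw [cutSum_insert _ c hiS, cutSum_insert _ c hiS]
  exact mul_left_cancel₀ hdi hfinal

end CutSums

section PairProducts

open Finset

theorem exists_perm_comp_eq {α γ : Type*} [Fintype α] [DecidableEq γ] (f g : α → γ)
    (h : ∀ c, #{a | f a = c} = #{a | g a = c}) : ∃ σ : Equiv.Perm α, f ∘ σ = g := by
  have e (c : γ) : {a // g a = c} ≃ {a // f a = c} :=
    Fintype.equivOfCardEq (by rw [Fintype.card_subtype, Fintype.card_subtype, h])
  exact ⟨Equiv.ofFiberEquiv e, funext fun a => Equiv.ofFiberEquiv_map e a⟩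

theorem prod_lt_mul_swap {R : Type*} [CommRing R] {n : ℕ} (θ : Fin n → Fin n → R)
    (hθ : ∀ a, θ a a = 1) :
    ∏ a, ∏ b with a < b, θ a b * θ b a = ∏ a, ∏ b, θ a b := by
  have h : ∏ a, ∏ b with a < b, θ b a = ∏ a, ∏ b with b < a, θ a b :=
    prod_comm' (by simp)
  simp only [prod_mul_distrib]
  rw [h, ← prod_mul_distrib]
  refine prod_congr rfl fun a _ => ?_
  rw [← prod_filter_mul_prod_filter_not univ (fun b => a < b)]
  congr 1
  rw [← prod_filter_mul_prod_filter_not ({b | ¬ a < b} : Finset (Fin n)) (fun b => b < a),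
    filter_filter, filter_filter]
  have h₁ : ({b | ¬ a < b ∧ b < a} : Finset (Fin n)) = ({b | b < a} : Finset (Fin n)) := by
    ext b
    simp only [mem_filter_univ]
    omega
  have h₂ : ({b | ¬ a < b ∧ ¬ b < a} : Finset (Fin n)) = {a} := by
    ext b
    simp only [mem_filter_univ, mem_singleton]
    omega
  rw [h₁, h₂, prod_singleton, hθ, mul_one]

theorem prod_lt_perm {R : Type*} [CommRing R] {n : ℕ} (s : Fin n → Fin n → R)
    (hs : ∀ a b, s a b = s b a) (σ : Equiv.Perm (Fin n)) :
    ∏ a, ∏ b with a < b, s (σ a) (σ b) = ∏ a, ∏ b with a < b, s a b := by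
  let θ (a b : Fin n) : R := if a < b then s (σ a) (σ b) else 1
  have h : ∏ a, ∏ b with a < b, s (σ a) (σ b) = ∏ a, ∏ b, θ a b := by
    simp only [θ, prod_filter]
  have h' : ∏ a, ∏ b, θ a b = ∏ a, ∏ b, θ (σ.symm a) (σ.symm b) := by
    rw [← Equiv.prod_comp σ.symm]
    exact prod_congr rfl fun a _ => (Equiv.prod_comp σ.symm _).symm
  rw [h, h', ← prod_lt_mul_swap _ (by simp [θ])]
  refine prod_congr rfl fun a _ => prod_congr rfl fun b hb => ?_
  have hb : a ≠ b := (mem_filter_univ b |>.1 hb).ne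
  have hb' : σ.symm a ≠ σ.symm b := σ.symm.injective.ne hb
  simp only [θ, Equiv.apply_symm_apply]
  rcases hb'.lt_or_gt with h | h
  · simp [h, h.not_gt]
  · simp [h, h.not_gt, hs a b]

end PairProducts

section Coloring

open Finset

theorem gam_congr {F : Type*} [Field F] (q t : F) {a b a' b' : ℕ} (y w : F)
    (h₁ : a = b ↔ a' = b') (h₂ : a < b ↔ a' < b') : gam q t a b y w = gam q t a' b' y w := by
  simp only [gam, h₁, h₂]

theorem gam_comm {F : Type*} [Field F] {q t : F} (hq : q ≠ 0) (ht : t ≠ 0) (a b : ℕ) (y w : F) :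
    gam q t a b y w = gam q t b a w y := by
  obtain rfl | hyw := eq_or_ne y w
  · simp [gam]
  have h₁ := sub_ne_zero.2 hyw
  have h₂ := sub_ne_zero.2 hyw.symm
  rcases lt_trichotomy a b with h | rfl | h
  · simp only [gam, h.ne, h.ne', h, h.not_gt, if_true, if_false]
    rw [div_eq_div_iff (pow_ne_zero _ h₁) (pow_ne_zero _ h₂)]
    field_simp
    ring
  · simp only [gam, if_true]
    rw [div_eq_div_iff (pow_ne_zero _ h₁) (pow_ne_zero _ h₂)]
    field_simp
    ring
  · simp only [gam, h.ne, h.ne', h, h.not_gt, if_true, if_false]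
    rw [div_eq_div_iff (pow_ne_zero _ h₁) (pow_ne_zero _ h₂)]
    field_simp
    ring

theorem om_eq {F : Type*} [Field F] {q t : F} (hq : q ≠ 0) {y w : F} (h₁ : y ≠ w)
    (h₂ : y ≠ t⁻¹ * w) :
    om q t y w = epsfac t y w * ruijFactor q⁻¹ (q * t⁻¹) y w := by
  have h₁ := sub_ne_zero.2 h₁
  have h₂ := sub_ne_zero.2 h₂
  rw [om, epsfac, ruijFactor, inv_mul_cancel_left₀ hq, div_mul_div_comm,
    div_eq_div_iff (by positivity) (by positivity)]
  ring

/-- The summand of the left-hand side attached to a colouring `f`, without its monomial. -/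
def colorProd {F : Type*} [Field F] {n M : ℕ} (q t : F) (z : Fin n → F) (f : Fin n → Fin M) : F :=
  ∏ a, ∏ b with a < b, gam q t (f a : ℕ) (f b : ℕ) (z a) (z b)

/-- The number of positions of each colour. -/
def content {n M : ℕ} (f : Fin n → Fin M) (k : Fin M) : ℕ := #{a | f a = k}

/-- Recolour the positions in `A` by the colour `k`. -/
def paint {n M : ℕ} (g : Fin n → Fin M) (k : Fin M) (A : Finset (Fin n)) (a : Fin n) : Fin M :=
  if a ∈ A then k else g a

theorem colorProd_perm {F : Type*} [Field F] {n M : ℕ} {q t : F} (hq : q ≠ 0) (ht : t ≠ 0)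
    (z : Fin n → F) (f : Fin n → Fin M) (σ : Equiv.Perm (Fin n)) :
    colorProd q t (z ∘ σ) f = colorProd q t z (f ∘ σ.symm) := by
  rw [colorProd, colorProd, ← prod_lt_perm
    (fun a b => gam q t ((f ∘ σ.symm) a : ℕ) ((f ∘ σ.symm) b : ℕ) (z a) (z b))
    (fun a b => gam_comm hq ht _ _ _ _) σ]
  simp

theorem colorProd_paint {F : Type*} [Field F] {n M : ℕ} {q t : F} (hq : q ≠ 0)
    (ht : t ≠ 0) (z : Fin n → F) (hz : ∀ i j, i ≠ j → ∀ k : ℤ, z i ≠ t⁻¹ ^ k * z j)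
    (i : Fin M) (g : Fin n → Fin (M + 1)) (hg : ∀ a, g a ≠ i.succ) (A : Finset (Fin n))
    (hA : A ⊆ ({a | g a = i.castSucc} : Finset (Fin n))) :
    colorProd q t z (paint g i.succ A) = colorProd q t z g *
      ∏ a ∈ ({a | g a = i.castSucc} : Finset (Fin n)) \ A, ∏ b ∈ A,
        ruijFactor q⁻¹ (q * t⁻¹) (z a) (z b) := by
  set U : Finset (Fin n) := {a | g a = i.castSucc} with hU
  let θ (a b : Fin n) : F :=
    if a ∈ U \ A then if b ∈ A then ruijFactor q⁻¹ (q * t⁻¹) (z a) (z b) else 1 else 1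
  have hθ : ∏ a ∈ U \ A, ∏ b ∈ A, ruijFactor q⁻¹ (q * t⁻¹) (z a) (z b) = ∏ a, ∏ b, θ a b := by
    simp only [θ]
    rw [prod_congr rfl fun a _ => (by split_ifs <;> simp :
      (∏ b, if a ∈ U \ A then if b ∈ A then ruijFactor q⁻¹ (q * t⁻¹) (z a) (z b) else 1 else 1) =
      if a ∈ U \ A then ∏ b ∈ A, ruijFactor q⁻¹ (q * t⁻¹) (z a) (z b) else 1)]
    rw [prod_ite_mem, univ_inter]
  rw [hθ, ← prod_lt_mul_swap θ (by intro a; simp only [θ, mem_sdiff]; split_ifs <;> simp_all),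
    colorProd, colorProd, ← prod_mul_distrib]
  refine prod_congr rfl fun a _ => ?_
  rw [← prod_mul_distrib]
  refine prod_congr rfl fun b hb => ?_
  have hab : a ≠ b := (mem_filter_univ b |>.1 hb).ne
  have hne {a b : Fin n} (hab : a ≠ b) : z a ≠ z b ∧ z a ≠ t⁻¹ * z b := by
    simpa using And.intro (hz a b hab 0) (hz a b hab 1)
  have key {a b : Fin n} (hab : a ≠ b) :
      gam q t i (i + 1) (z a) (z b) =
        gam q t i i (z a) (z b) * ruijFactor q⁻¹ (q * t⁻¹) (z a) (z b) := by
    simpa [gam, om, epsfac] using om_eq hq (hne hab).1 (hne hab).2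
  have hgv (a : Fin n) : (g a : ℕ) ≠ i + 1 := fun h => hg a (Fin.ext (by simpa using h))
  have hUv (a : Fin n) : a ∈ U ↔ (g a : ℕ) = i := by
    rw [hU, mem_filter_univ, Fin.ext_iff, Fin.val_castSucc]
  have hAU (a : Fin n) (ha : a ∈ A) : (g a : ℕ) = i := (hUv a).1 (hA ha)
  by_cases haA : a ∈ A <;> by_cases hbA : b ∈ A
  · simp [θ, paint, haA, hbA, hAU, gam]
  · by_cases hbU : b ∈ U
    · have hb := (hUv b).1 hbU
      simp only [θ, paint, haA, hbA, hbU, hAU a haA, hb, mem_sdiff, if_true, if_false,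
        not_true, not_false_iff, and_true, and_false, Fin.val_succ, one_mul]
      rw [gam_comm hq ht, key hab.symm, gam_comm hq ht i i]
    · have hb := mt (hUv b).2 hbU
      simp only [θ, paint, haA, hbA, hbU, hAU a haA, mem_sdiff, if_true, if_false,
        not_true, false_and, and_false, Fin.val_succ, mul_one]
      have := hgv b
      exact gam_congr _ _ _ _ (by omega) (by omega)
  · by_cases haU : a ∈ U
    · have ha := (hUv a).1 haU
      simp only [θ, paint, haA, hbA, haU, hAU b hbA, ha, mem_sdiff, if_true, if_false,
        not_true, not_false_iff, and_true, and_false, Fin.val_succ, mul_one]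
      rw [key hab]
    · have ha := mt (hUv a).2 haU
      simp only [θ, paint, haA, hbA, haU, hAU b hbA, mem_sdiff, if_true, if_false,
        not_true, false_and, and_false, Fin.val_succ, mul_one]
      have := hgv a
      exact gam_congr _ _ _ _ (by omega) (by omega)
  · simp [θ, paint, haA, hbA]

theorem sum_colorProd_paint {F : Type*} [Field F] {n M : ℕ} {q t : F} (hq : q ≠ 0)
    (ht : t ≠ 0) (htk : ∀ k : ℤ, t⁻¹ ^ k = 1 → k = 0) (z : Fin n → F) (hz0 : ∀ a, z a ≠ 0)
    (hz : ∀ i j, i ≠ j → ∀ k : ℤ, z i ≠ t⁻¹ ^ k * z j)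
    (i : Fin M) (g : Fin n → Fin (M + 1)) (hg : ∀ a, g a ≠ i.succ) (c : ℕ → F) :
    ∑ A ∈ ({a | g a = i.castSucc} : Finset (Fin n)).powerset,
        c #A * colorProd q t z (paint g i.succ A) =
      ∑ A ∈ ({a | g a = i.castSucc} : Finset (Fin n)).powerset,
        c #A * colorProd q t z (paint g i.succ (({a | g a = i.castSucc} : Finset (Fin n)) \ A)) := by
  set U : Finset (Fin n) := {a | g a = i.castSucc} with hU
  have h := congrArg (colorProd q t z g * ·)
    (cutSum_ruijFactor_comm z q⁻¹ (q * t⁻¹) (inv_ne_zero hq) (mul_ne_zero hq (inv_ne_zero ht))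
      (by simpa [hq] using htk) hz0 (by simpa [hq] using hz) U c)
  simp only [cutSum, mul_sum] at h
  refine Eq.trans (sum_congr rfl fun A hA => ?_) (h.symm.trans (sum_congr rfl fun A hA => ?_))
  · rw [colorProd_paint hq ht z hz i g hg A (mem_powerset.1 hA), prod_comm]
    ring
  · rw [colorProd_paint hq ht z hz i g hg (U \ A) sdiff_subset,
      Finset.sdiff_sdiff_eq_self (mem_powerset.1 hA)]
    ring

theorem sum_colorProd_swap {F : Type*} [Field F] {n M : ℕ} {q t : F} (hq : q ≠ 0)
    (ht : t ≠ 0) (htk : ∀ k : ℤ, t⁻¹ ^ k = 1 → k = 0) (z : Fin n → F) (hz0 : ∀ a, z a ≠ 0)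
    (hz : ∀ i j, i ≠ j → ∀ k : ℤ, z i ≠ t⁻¹ ^ k * z j) (i : Fin M) (w : (Fin (M + 1) → ℕ) → F) :
    ∑ f : Fin n → Fin (M + 1), w (content f) * colorProd q t z f =
      ∑ f : Fin n → Fin (M + 1), w (content f) *
        colorProd q t z (Equiv.swap i.castSucc i.succ ∘ f) := by
  have hne : i.castSucc ≠ i.succ := i.castSucc_lt_succ.ne
  let κ (k : Fin (M + 1)) : Fin (M + 1) := if k = i.succ then i.castSucc else k
  rw [← sum_fiberwise _ (fun f => κ ∘ f), ← sum_fiberwise univ (fun f => κ ∘ f)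
    (fun f => w (content f) * colorProd q t z (Equiv.swap i.castSucc i.succ ∘ f))]
  refine sum_congr rfl fun g _ => ?_
  by_cases hg : ∀ a, g a ≠ i.succ
  swap
  · obtain ⟨a, ha⟩ := not_forall_not.1 hg
    rw [filter_eq_empty_iff.2 fun f _ hf => ?_, sum_empty, sum_empty]
    have := congrFun hf a
    simp only [κ, Function.comp_apply, ha] at this
    split_ifs at this with h
    · exact hne this
    · exact h this
  set U : Finset (Fin n) := {a | g a = i.castSucc} with hU
  have hbij (H : (Fin n → Fin (M + 1)) → F) :
      ∑ f with κ ∘ f = g, H f = ∑ A ∈ U.powerset, H (paint g i.succ A) := by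
    have hinv (f : Fin n → Fin (M + 1)) (hf : κ ∘ f = g) :
        paint g i.succ {a | f a = i.succ} = f := by
      ext1 a
      have := congrFun hf a
      by_cases h : f a = i.succ
      · simp [paint, h]
      · simp only [κ, Function.comp_apply, h, if_false] at this
        simp [paint, this, hg]
    refine sum_bij' (fun f _ => ({a | f a = i.succ} : Finset (Fin n)))
      (fun A _ => paint g i.succ A) ?_ ?_ ?_ ?_ ?_
    · intro f hf
      obtain rfl := (mem_filter_univ f).1 hf
      rw [mem_powerset]
      intro a ha
      simp_all [κ]
    · intro A hA
      rw [mem_filter_univ]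
      ext1 a
      by_cases h : a ∈ A
      · have := mem_powerset.1 hA h
        simp_all [κ, paint]
      · simp [κ, paint, h, hg]
    · intro f hf
      exact hinv f ((mem_filter_univ f).1 hf)
    · intro A hA
      ext a
      simp [paint, hg]
    · intro f hf
      rw [hinv f ((mem_filter_univ f).1 hf)]
  rw [hbij, hbij]
  let c (k : ℕ) : F := w fun l =>
    if l = i.succ then k else if l = i.castSucc then #U - k else content g l
  have hc (A : Finset (Fin n)) (hA : A ∈ U.powerset) : w (content (paint g i.succ A)) = c #A := by
    have hA := mem_powerset.1 hA
    simp only [c]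
    congr 1
    ext l
    rw [content]
    split_ifs with h₁ h₂
    · congr 1
      ext a
      simp [paint, h₁, hg]
    · rw [← card_sdiff_of_subset hA]
      congr 1
      ext a
      by_cases h : a ∈ A <;> simp [paint, h, h₂, hne.symm, hU]
    · rw [content]
      congr 1
      ext a
      by_cases h : a ∈ A
      · have := hA h
        simp_all [paint, eq_comm]
      · rw [mem_filter_univ, mem_filter_univ, paint, if_neg h]
  have hswap (A : Finset (Fin n)) (hA : A ∈ U.powerset) :
      Equiv.swap i.castSucc i.succ ∘ paint g i.succ A = paint g i.succ (U \ A) := by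
    have hA := mem_powerset.1 hA
    ext1 a
    by_cases h : a ∈ A
    · have := hA h
      simp_all [paint]
    · by_cases h' : g a = i.castSucc
      · simp [paint, h, hU, h']
      · simp [paint, h, hU, h', Equiv.swap_apply_of_ne_of_ne h' (hg a)]
  rw [sum_congr rfl fun A hA => by rw [hc A hA],
    sum_colorProd_paint hq ht htk z hz0 hz i g hg c]
  exact sum_congr rfl fun A hA => by rw [hc A hA, hswap A hA]

/-- The sum of `colorProd` over all colourings of a given content. -/
def contentSum {F : Type*} [Field F] {n M : ℕ} (q t : F) (z : Fin n → F) (a : Fin M → ℕ) : F :=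
  ∑ f : Fin n → Fin M with content f = a, colorProd q t z f

theorem content_perm_comp {n M : ℕ} (s : Equiv.Perm (Fin M)) (f : Fin n → Fin M) :
    content (s ∘ f) = content f ∘ s.symm := by
  ext k
  simp only [content, Function.comp_apply, Equiv.eq_symm_apply]

theorem contentSum_comp_perm {F : Type*} [Field F] {n M : ℕ} {q t : F} (hq : q ≠ 0)
    (ht : t ≠ 0) (htk : ∀ k : ℤ, t⁻¹ ^ k = 1 → k = 0) (z : Fin n → F) (hz0 : ∀ a, z a ≠ 0)
    (hz : ∀ i j, i ≠ j → ∀ k : ℤ, z i ≠ t⁻¹ ^ k * z j) (π : Equiv.Perm (Fin (M + 1))) :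
    ∀ a : Fin (M + 1) → ℕ, contentSum q t z (a ∘ π) = contentSum q t z a := by
  have hπ : π ∈ Submonoid.closure
      (Set.range fun i : Fin M => Equiv.swap i.castSucc i.succ) := by
    rw [Equiv.Perm.mclosure_swap_castSucc_succ]
    trivial
  induction hπ using Submonoid.closure_induction with
  | mem s hs =>
    obtain ⟨i, rfl⟩ := hs
    intro a
    have h := sum_colorProd_swap hq ht htk z hz0 hz i fun b => if b = a then 1 else 0
    simp only [ite_mul, one_mul, zero_mul, ← sum_filter] at h
    rw [contentSum, contentSum, h]
    set s := Equiv.swap i.castSucc i.succ with hs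
    have hss : s.symm = s := Equiv.symm_swap _ _
    have hss' (k) : s (s k) = k := by simp [s]
    refine sum_nbij' (s ∘ ·) (s ∘ ·) ?_ ?_ ?_ ?_ ?_
    · intro f hf
      have hf : content f = a ∘ s := (mem_filter_univ f).1 hf
      rw [mem_filter_univ, content_perm_comp, hf, hss]
      ext k
      simp [hss']
    · intro f hf
      rw [mem_filter_univ] at hf ⊢
      rw [content_perm_comp, hf, hss]
    all_goals
      intro f hf
      simp [Function.comp_def, hss']
  | one => exact fun a => rfl
  | mul s s' _ _ h h' =>
    intro a
    rw [Equiv.Perm.coe_mul, ← Function.comp_assoc, h', h]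

theorem card_perm_comp_eq {n M : ℕ} (f g : Fin n → Fin M) :
    #{σ : Equiv.Perm (Fin n) | f ∘ σ = g} =
      if content g = content f then ∏ k, (content f k).factorial else 0 := by
  split_ifs with h
  · obtain ⟨τ, rfl⟩ := exists_perm_comp_eq f g fun k => (congrFun h k).symm
    have := DomMulAct.stabilizer_card f
    simp only [Fintype.card_subtype] at this
    simp only [content]
    rw [← this]
    refine card_nbij' (· * τ⁻¹) (· * τ) ?_ ?_ ?_ ?_
    · intro σ hσ
      simp only [mem_coe, mem_filter_univ] at hσ ⊢
      rw [Equiv.Perm.coe_mul, ← Function.comp_assoc, hσ, Function.comp_assoc,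
        ← Equiv.Perm.coe_mul]
      simp
    · intro σ hσ
      simp only [mem_coe, mem_filter_univ] at hσ ⊢
      rw [Equiv.Perm.coe_mul, ← Function.comp_assoc, hσ]
    · intro σ _
      simp
    · intro σ _
      simp
  · rw [card_eq_zero, filter_eq_empty_iff]
    rintro σ _ rfl
    refine h (funext fun k => ?_)
    exact card_bijective σ σ.bijective (by simp)

theorem sum_perm_colorProd {F : Type*} [Field F] {n M : ℕ} (q t : F) (z : Fin n → F)
    (f : Fin n → Fin M) :
    ∑ σ : Equiv.Perm (Fin n), colorProd q t z (f ∘ σ) =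
      (∏ k, (content f k).factorial : ℕ) * contentSum q t z (content f) := by
  rw [← sum_fiberwise univ fun σ : Equiv.Perm (Fin n) => f ∘ σ, contentSum, mul_sum, sum_filter]
  refine sum_congr rfl fun g _ => ?_
  rw [sum_congr rfl fun σ hσ => by rw [(mem_filter_univ σ).1 hσ], sum_const, card_perm_comp_eq]
  split_ifs <;> simp

end Coloring

section Genericity

theorem t_pow_ne_one (m n : ℕ) {k : ℕ} (hk : k ≠ 0) : t m n ^ k ≠ 1 := by
  intro h
  rw [t, ← map_pow, ← map_one (algebraMap (MvPolynomial (Fin 2 ⊕ Fin m ⊕ Fin n) ℚ) (K m n))] at h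
  have h := congrArg (MvPolynomial.eval 0) (IsFractionRing.injective _ (K m n) h)
  simp [hk] at h

theorem z_ne_t_pow_mul (m n : ℕ) {i j : Fin n} (hij : i ≠ j) (k : ℕ) :
    z m n i ≠ t m n ^ k * z m n j := by
  intro h
  rw [t, z, z, ← map_pow, ← map_mul] at h
  have h := congrArg (MvPolynomial.eval fun v => if v = Sum.inr (Sum.inr i) then 0 else 1)
    (IsFractionRing.injective _ (K m n) h)
  simp [hij.symm] at h

theorem algebraMap_X_ne_zero (m n : ℕ) (v : Fin 2 ⊕ Fin m ⊕ Fin n) :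
    algebraMap (MvPolynomial (Fin 2 ⊕ Fin m ⊕ Fin n) ℚ) (K m n) (MvPolynomial.X v) ≠ 0 := by
  simp [MvPolynomial.X_ne_zero]

theorem q_ne_zero (m n : ℕ) : q m n ≠ 0 := algebraMap_X_ne_zero m n _

theorem t_ne_zero (m n : ℕ) : t m n ≠ 0 := algebraMap_X_ne_zero m n _

theorem z_ne_zero (m n : ℕ) (a : Fin n) : z m n a ≠ 0 := algebraMap_X_ne_zero m n _

theorem t_inv_zpow_eq_one (m n : ℕ) (k : ℤ) (h : (t m n)⁻¹ ^ k = 1) : k = 0 := by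
  by_contra hk
  obtain ⟨k, rfl | rfl⟩ := k.eq_nat_or_neg <;>
    exact t_pow_ne_one m n (by simpa using hk) (by simpa using h)

theorem z_ne_t_inv_zpow_mul (m n : ℕ) (i j : Fin n) (hij : i ≠ j) (k : ℤ) :
    z m n i ≠ (t m n)⁻¹ ^ k * z m n j := by
  intro h
  obtain ⟨k, rfl | rfl⟩ := k.eq_nat_or_neg
  · refine z_ne_t_pow_mul m n hij.symm k ?_
    rw [h]
    simp [t_ne_zero]
  · exact z_ne_t_pow_mul m n hij k (by simpa using h)

end Genericity

section Blocks

open Finset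

/-- The index of the block of `L` containing `a`, when `0, 1, 2, …` is cut into consecutive blocks
whose sizes are the entries of `L`. -/
def blockIndex (L : List ℕ) (a : ℕ) : ℕ := #{k ∈ range L.length | (L.take (k + 1)).sum ≤ a}

theorem blockIndex_mono (L : List ℕ) : Monotone (blockIndex L) := fun _ _ h =>
  card_le_card <| monotone_filter_right _ fun _ _ h' => h'.trans h

theorem blockIndex_cons_of_lt {c a : ℕ} (L : List ℕ) (h : a < c) :
    blockIndex (c :: L) a = 0 := by
  rw [blockIndex, card_eq_zero, filter_eq_empty_iff]
  intro k _
  rw [List.take_succ_cons, List.sum_cons]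
  omega

theorem blockIndex_cons_add (c a : ℕ) (L : List ℕ) :
    blockIndex (c :: L) (c + a) = blockIndex L a + 1 := by
  simp only [blockIndex, card_filter, List.length_cons, sum_range_succ', List.take_succ_cons,
    List.sum_cons, Nat.add_le_add_iff_left]
  simp

theorem blockIndex_lt_length (L : List ℕ) : ∀ a < L.sum, blockIndex L a < L.length := by
  induction L with
  | nil => simp
  | cons c L ih =>
    intro a ha
    rcases lt_or_ge a c with h | h
    · simp [blockIndex_cons_of_lt L h]
    · obtain ⟨a, rfl⟩ := Nat.exists_eq_add_of_le h
      rw [List.sum_cons] at ha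
      rw [blockIndex_cons_add, List.length_cons]
      exact Nat.succ_lt_succ (ih a (by omega))

theorem count_blockIndex (L : List ℕ) (k : ℕ) :
    Nat.count (fun a => blockIndex L a = k) L.sum = L.getD k 0 := by
  induction L generalizing k with
  | nil => simp
  | cons c L ih =>
    rw [List.sum_cons, Nat.count_add]
    simp only [blockIndex_cons_add]
    have h : Nat.count (fun a => blockIndex (c :: L) a = k) c = if 0 = k then c else 0 := by
      rw [Nat.count_eq_card_filter_range, filter_congr fun a ha => by
        rw [blockIndex_cons_of_lt L (mem_range.1 ha)]]
      split_ifs with h <;> simp [h]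
    rw [h]
    cases k with
    | zero => simp [Nat.count_eq_card_filter_range]
    | succ k => simpa using ih k

theorem sum_partsList {n : ℕ} (p : n.Partition) : (partsList p).sum = n := by
  rw [partsList, List.sum_reverse, ← Multiset.sum_coe, Multiset.sort_eq, p.parts_sum]

theorem coe_partsList {n : ℕ} (p : n.Partition) : (partsList p : Multiset ℕ) = p.parts := by
  rw [partsList, Multiset.coe_reverse, Multiset.sort_eq]

theorem length_partsList {n : ℕ} (p : n.Partition) : (partsList p).length = p.parts.card := by
  rw [← coe_partsList, Multiset.coe_card]

/-- The colouring of the positions of the blocks of a partition by their indices. -/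
def blockColoring {n M : ℕ} (p : n.Partition) (hp : p.parts.card ≤ M) (a : Fin n) : Fin M :=
  ⟨blk p a, (blockIndex_lt_length _ a (by simp [sum_partsList])).trans_le
    (length_partsList p ▸ hp)⟩

theorem content_blockColoring {n M : ℕ} (p : n.Partition) (hp : p.parts.card ≤ M) (k : Fin M) :
    content (blockColoring p hp) k = (partsList p).getD k 0 := by
  rw [← count_blockIndex, sum_partsList, Nat.count_eq_card_filter_range, card_filter, content,
    card_filter, ← Fin.sum_univ_eq_sum_range fun a =>
      if blockIndex (partsList p) a = (k : ℕ) then 1 else 0]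
  simp only [blockColoring, Fin.ext_iff]
  rfl

theorem map_content_blockColoring {n M : ℕ} (p : n.Partition) (hp : p.parts.card ≤ M) :
    univ.val.map (content (blockColoring p hp)) =
      p.parts + Multiset.replicate (M - p.parts.card) 0 := by
  rw [Fin.univ_val_map, ← Multiset.coe_replicate, ← length_partsList, ← coe_partsList,
    Multiset.coe_add]
  rw [← length_partsList] at hp
  congr 1
  refine List.ext_getElem (by simp [hp]) fun k h₁ h₂ => ?_
  rw [List.getElem_ofFn, content_blockColoring]
  rcases lt_or_ge k (partsList p).length with h | h
  · simp [List.getElem_append_left h, h]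
  · simp [List.getElem_append_right h, h]

theorem gam_blockColoring {F : Type*} [Field F] {n M : ℕ} (q t : F) (p : n.Partition)
    (hp : p.parts.card ≤ M) {a b : Fin n} (hab : a < b) (y w : F) :
    gam q t (blockColoring p hp a : ℕ) (blockColoring p hp b : ℕ) y w =
      if blk p a = blk p b then epsfac t y w else om q t y w := by
  have h : blk p a ≤ blk p b := blockIndex_mono _ hab.le
  change gam q t (blk p a) (blk p b) y w = _
  by_cases h' : blk p a = blk p b
  · rw [gam, if_pos h', if_pos h', epsfac]
  · rw [gam, if_neg h', if_pos (h.lt_of_ne h'), if_neg h', om]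

end Blocks

section Assembly

open Finset

theorem factorial_mul_epsPart (m n : ℕ) (p : n.Partition) (a : Fin (m + 1) → ℕ)
    (ha : univ.val.map a = p.parts + Multiset.replicate (m + 1 - p.parts.card) 0) :
    (n.factorial : K (m + 1) n) * epsPart (m + 1) n p =
      ((p.parts.map Nat.factorial).prod : ℕ) *
        contentSum (q (m + 1) n) (t (m + 1) n) (z (m + 1) n) a := by
  have hp : p.parts.card ≤ m + 1 := by
    have := congrArg Multiset.card ha
    simp only [Multiset.card_map, card_val, card_univ, Fintype.card_fin, Multiset.card_add,
      Multiset.card_replicate] at this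
    omega
  have hq := q_ne_zero (m + 1) n
  have ht := t_ne_zero (m + 1) n
  set g := blockColoring p hp with hg
  have hmap : univ.val.map (content g) = univ.val.map a := by
    rw [ha, hg, map_content_blockColoring]
  have hfac : ∏ k, (content g k).factorial = (p.parts.map Nat.factorial).prod := by
    rw [prod_eq_multiset_prod, ← Function.comp_def Nat.factorial, ← Multiset.map_map,
      map_content_blockColoring, Multiset.map_add, Multiset.prod_add]
    simp
  obtain ⟨π, hπ⟩ := exists_perm_comp_eq (content g) a fun c => by
    have := congrArg (Multiset.count c) hmap
    rw [Multiset.count_map, Multiset.count_map] at this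
    simpa only [eq_comm, card_def, filter_val] using this
  rw [epsPart, mul_inv_cancel_left₀ (Nat.cast_ne_zero.2 n.factorial_ne_zero), ← hfac, ← hπ,
    contentSum_comp_perm hq ht (t_inv_zpow_eq_one _ _) _ (z_ne_zero _ _)
      (z_ne_t_inv_zpow_mul _ _), ← sum_perm_colorProd, ← Equiv.sum_comp (Equiv.inv _)]
  refine sum_congr rfl fun σ _ => ?_
  refine Eq.trans ?_ (colorProd_perm hq ht (z (m + 1) n) g σ⁻¹)
  rw [colorProd]
  refine prod_congr rfl fun i _ => prod_congr rfl fun j hj => ?_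
  rw [hg, gam_blockColoring _ _ _ _ ((mem_filter_univ j).1 hj)]
  rfl

theorem sum_content {n M : ℕ} (f : Fin n → Fin M) : ∑ k, content f k = n := by
  simpa [content] using (card_eq_sum_card_fiberwise (s := univ) (t := univ) (f := f)
    fun _ _ => mem_univ _).symm

theorem prod_pow_content {R : Type*} [CommRing R] {n M : ℕ} (y : Fin M → R) (f : Fin n → Fin M) :
    ∏ a, y (f a) = ∏ k, y k ^ content f k := by
  rw [← prod_fiberwise univ f]
  refine prod_congr rfl fun k _ => ?_
  rw [prod_congr rfl fun a ha => by rw [(mem_filter_univ a).1 ha], prod_const]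
  rfl

theorem map_eq_parts_add_replicate_iff {n M : ℕ} (a : Fin M → ℕ) (ha : (univ.val.map a).sum = n)
    (p : n.Partition) :
    univ.val.map a = p.parts + Multiset.replicate (M - p.parts.card) 0 ↔
      p = Nat.Partition.ofSums n (univ.val.map a) ha := by
  have hp : p.parts.filter (· ≠ 0) = p.parts :=
    Multiset.filter_eq_self.2 fun k hk => (p.parts_pos hk).ne'
  constructor
  · intro h
    ext1
    rw [Nat.Partition.ofSums_parts, h, Multiset.filter_add, hp]
    simpa [Multiset.filter_eq_nil] using fun k => Multiset.eq_of_mem_replicate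
  · rintro rfl
    rw [Nat.Partition.ofSums_parts]
    conv_lhs => rw [← Multiset.filter_add_not (· ≠ 0) (univ.val.map a)]
    congr 1
    rw [Multiset.eq_replicate]
    have := congrArg Multiset.card (Multiset.filter_add_not (· ≠ 0) (univ.val.map a))
    simp only [Multiset.card_add, Multiset.card_map, card_val, card_univ, Fintype.card_fin] at this
    refine ⟨by omega, fun k hk => ?_⟩
    simpa using (Multiset.mem_filter.1 hk).2

theorem sum_colorProd_eq_sum_contentSum {F : Type*} [Field F] {n M : ℕ} (q t : F) (z : Fin n → F)
    (y : Fin M → F) :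
    ∑ f : Fin n → Fin M, (∏ a, y (f a)) * colorProd q t z f =
      ∑ a : Fin M → Fin (n + 1),
        (∏ k, y k ^ (a k : ℕ)) * contentSum q t z fun k => (a k : ℕ) := by
  have hc (f : Fin n → Fin M) (k : Fin M) : content f k < n + 1 := by
    have := sum_content f
    have := single_le_sum (f := content f) (fun _ _ => Nat.zero_le _) (mem_univ k)
    omega
  rw [← sum_fiberwise univ fun f k => (⟨content f k, hc f k⟩ : Fin (n + 1))]
  refine sum_congr rfl fun a _ => ?_
  rw [contentSum, mul_sum]
  refine sum_congr (filter_congr fun f _ => ?_) fun f hf => ?_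
  · simp only [funext_iff, Fin.ext_iff]
  · rw [prod_pow_content, (mem_filter_univ f).1 hf]

end Assembly

/-- `Σ_{f : {1,…,n} → {1,…,m}} (∏_α x_{f(α)}) ∏_{α<β} γ_{f(α),f(β)}(z_α,z_β;q,t)
  = Σ_{λ ⊢ n} (n!/∏ λ_i!) m_λ(x) ε_λ(z;t)`. -/
theorem stmt7 (m n : ℕ) (hm : 1 ≤ m) (hn : 1 ≤ n) :
    (∑ f : Fin n → Fin m,
      (∏ a : Fin n, x m n (f a)) *
        ∏ a : Fin n, ∏ b ∈ Finset.univ.filter fun b => a < b,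
          gam (q m n) (t m n) (f a : ℕ) (f b : ℕ) (z m n a) (z m n b))
    = ∑ p : n.Partition,
        ((n.factorial : K m n) / (((p.parts.map Nat.factorial).prod : ℕ) : K m n)) *
          msymm m n p * epsPart m n p := by
  obtain ⟨m, rfl⟩ := Nat.exists_eq_add_of_le' hm
  refine (sum_colorProd_eq_sum_contentSum _ _ _ _).trans ?_
  have hterm (p : n.Partition) (a : Fin (m + 1) → Fin (n + 1)) :
      (n.factorial : K (m + 1) n) / ((p.parts.map Nat.factorial).prod : ℕ) *
        (if (Finset.univ.val.map fun i => (a i : ℕ)) =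
            p.parts + Multiset.replicate (m + 1 - p.parts.card) 0 then
          ∏ i, x (m + 1) n i ^ (a i : ℕ) else 0) * epsPart (m + 1) n p =
      if (Finset.univ.val.map fun i => (a i : ℕ)) =
          p.parts + Multiset.replicate (m + 1 - p.parts.card) 0 then
        (∏ i, x (m + 1) n i ^ (a i : ℕ)) * contentSum (q (m + 1) n) (t (m + 1) n) (z (m + 1) n)
          fun i => (a i : ℕ) else 0 := by
    split_ifs with h
    · have hne : (((p.parts.map Nat.factorial).prod : ℕ) : K (m + 1) n) ≠ 0 := by
        refine Nat.cast_ne_zero.2 (Multiset.prod_ne_zero fun h => ?_)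
        obtain ⟨k, _, hk⟩ := Multiset.mem_map.1 h
        exact k.factorial_ne_zero hk
      rw [mul_right_comm, div_mul_eq_mul_div, factorial_mul_epsPart m n p _ h,
        mul_div_cancel_left₀ _ hne, mul_comm]
    · simp
  simp only [msymm, Finset.mul_sum, Finset.sum_mul, hterm]
  rw [Finset.sum_comm]
  refine Finset.sum_congr rfl fun a _ => ?_
  by_cases ha : ∑ k, (a k : ℕ) = n
  · simp only [map_eq_parts_add_replicate_iff (fun k => (a k : ℕ)) ha]
    simp
  · have h : contentSum (q (m + 1) n) (t (m + 1) n) (z (m + 1) n) (fun i => (a i : ℕ)) = 0 := by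
      rw [contentSum, Finset.filter_eq_empty_iff.2, Finset.sum_empty]
      intro f _ hf
      exact ha (hf ▸ sum_content f)
    simp [h]

end
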